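/- The real scalar function v(x,t) = −2 C E(x,t)⁻¹ B satisfies the focusing modified Korteweg–de Vries equation v_t + v_{xxx} + 6v²v_x = 0 at every point of the (x,t)-plane, and moreover v(x,t) = u(x,t) for all (x,t), where u(x,t) = −2 Bᵀ F(x,t)⁻¹ Cᵀ. -/

import Mathlib

open Matrix MeasureTheory Filter

noncomputable def mexp {p : ℕ} (M : Matrix (Fin p) (Fin p) ℝ) : Matrix (Fin p) (Fin p) ℝ :=
  ∑' k : ℕ, (k.factorial : ℝ)⁻¹ • M ^ k

def EigPos {p : ℕ} (A : Matrix (Fin p) (Fin p) ℝ) : Prop :=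
  ∀ μ ∈ spectrum ℂ (A.map Complex.ofReal), 0 < μ.re

def Observable {p : ℕ} (A : Matrix (Fin p) (Fin p) ℝ) (C : Matrix (Fin 1) (Fin p) ℝ) : Prop :=
  ∀ v : Fin p → ℝ, (∀ r : ℕ, (C * A ^ r) *ᵥ v = 0) → v = 0

def Controllable {p : ℕ} (A : Matrix (Fin p) (Fin p) ℝ) (B : Matrix (Fin p) (Fin 1) ℝ) : Prop :=
  ∀ v : Fin p → ℝ, (∀ r : ℕ, (Bᵀ * Aᵀ ^ r) *ᵥ v = 0) → v = 0

noncomputable def Qmat {p : ℕ} (A : Matrix (Fin p) (Fin p) ℝ) (C : Matrix (Fin 1) (Fin p) ℝ) :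
    Matrix (Fin p) (Fin p) ℝ :=
  Matrix.of fun i j =>
    ∫ s in Set.Ioi (0 : ℝ), (mexp (-(s • Aᵀ)) * (Cᵀ * C) * mexp (-(s • A))) i j

noncomputable def Nmat {p : ℕ} (A : Matrix (Fin p) (Fin p) ℝ) (B : Matrix (Fin p) (Fin 1) ℝ) :
    Matrix (Fin p) (Fin p) ℝ :=
  Matrix.of fun i j =>
    ∫ s in Set.Ioi (0 : ℝ), (mexp (-(s • A)) * (B * Bᵀ) * mexp (-(s • Aᵀ))) i j

noncomputable def Pmat {p : ℕ} (A : Matrix (Fin p) (Fin p) ℝ) (B : Matrix (Fin p) (Fin 1) ℝ)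
    (C : Matrix (Fin 1) (Fin p) ℝ) : Matrix (Fin p) (Fin p) ℝ :=
  Matrix.of fun i j =>
    ∫ s in Set.Ioi (0 : ℝ), (mexp (-(s • A)) * (B * C) * mexp (-(s • A))) i j

noncomputable def Fmat {p : ℕ} (A : Matrix (Fin p) (Fin p) ℝ) (B : Matrix (Fin p) (Fin 1) ℝ)
    (C : Matrix (Fin 1) (Fin p) ℝ) (x t : ℝ) : Matrix (Fin p) (Fin p) ℝ :=
  mexp ((2 * x) • Aᵀ - (8 * t) • Aᵀ ^ 3) +
    Qmat A C * mexp (-((2 * x) • A) + (8 * t) • A ^ 3) * Nmat A B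

noncomputable def Emat {p : ℕ} (A : Matrix (Fin p) (Fin p) ℝ) (B : Matrix (Fin p) (Fin 1) ℝ)
    (C : Matrix (Fin 1) (Fin p) ℝ) (x t : ℝ) : Matrix (Fin p) (Fin p) ℝ :=
  mexp ((2 * x) • A - (8 * t) • A ^ 3) +
    Pmat A B C * mexp (-((2 * x) • A) + (8 * t) • A ^ 3) * Pmat A B C

noncomputable def uFun {p : ℕ} (A : Matrix (Fin p) (Fin p) ℝ) (B : Matrix (Fin p) (Fin 1) ℝ)
    (C : Matrix (Fin 1) (Fin p) ℝ) (x t : ℝ) : ℝ :=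
  -2 * ((Bᵀ * (Fmat A B C x t)⁻¹ * Cᵀ : Matrix (Fin 1) (Fin 1) ℝ) 0 0)

noncomputable def vFun {p : ℕ} (A : Matrix (Fin p) (Fin p) ℝ) (B : Matrix (Fin p) (Fin 1) ℝ)
    (C : Matrix (Fin 1) (Fin p) ℝ) (x t : ℝ) : ℝ :=
  -2 * ((C * (Emat A B C x t)⁻¹ * B : Matrix (Fin 1) (Fin 1) ℝ) 0 0)

noncomputable def calQ {p : ℕ} (A : Matrix (Fin p) (Fin p) ℝ) (C : Matrix (Fin 1) (Fin p) ℝ)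
    (x t : ℝ) : Matrix (Fin p) (Fin p) ℝ :=
  mexp (-(x • Aᵀ)) * mexp ((8 * t) • Aᵀ ^ 3) * Qmat A C * mexp (-(x • A)) * mexp ((8 * t) • A ^ 3)

noncomputable def calN {p : ℕ} (A : Matrix (Fin p) (Fin p) ℝ) (B : Matrix (Fin p) (Fin 1) ℝ)
    (x : ℝ) : Matrix (Fin p) (Fin p) ℝ :=
  mexp (-(x • A)) * Nmat A B * mexp (-(x • Aᵀ))

noncomputable def Gam {p : ℕ} (A : Matrix (Fin p) (Fin p) ℝ) (B : Matrix (Fin p) (Fin 1) ℝ)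
    (C : Matrix (Fin 1) (Fin p) ℝ) (x t : ℝ) : Matrix (Fin p) (Fin p) ℝ :=
  1 + calQ A C x t * calN A B x

noncomputable def Om {p : ℕ} (A : Matrix (Fin p) (Fin p) ℝ) (B : Matrix (Fin p) (Fin 1) ℝ)
    (C : Matrix (Fin 1) (Fin p) ℝ) (w t : ℝ) : ℝ :=
  ((C * mexp (-(w • A)) * mexp ((8 * t) • A ^ 3) * B : Matrix (Fin 1) (Fin 1) ℝ) 0 0)

noncomputable def Kker {p : ℕ} (A : Matrix (Fin p) (Fin p) ℝ) (B : Matrix (Fin p) (Fin 1) ℝ)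
    (C : Matrix (Fin 1) (Fin p) ℝ) (x y t : ℝ) : ℝ :=
  ((Bᵀ * (Fmat A B C x t)⁻¹ * mexp (-((y - x) • Aᵀ)) * Cᵀ : Matrix (Fin 1) (Fin 1) ℝ) 0 0)


section abs
variable {𝔸 : Type*} [NormedRing 𝔸] [NormedAlgebra ℝ 𝔸] [CompleteSpace 𝔸]

theorem abs_hasDerivAt_exp_aux (L M : 𝔸) (h : Commute L M) (x : ℝ) :
    HasDerivAt (fun y : ℝ => NormedSpace.exp (y • L + M)) (L * NormedSpace.exp (x • L + M)) x := by
  let _ : NormedAlgebra ℚ 𝔸 := NormedAlgebra.restrictScalars ℚ ℝ 𝔸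
  have h1 : ∀ y : ℝ, NormedSpace.exp (y • L + M) = NormedSpace.exp (y • L) * NormedSpace.exp M :=
    fun y => NormedSpace.exp_add_of_commute (h.smul_left y)
  simp only [h1]
  have := (hasDerivAt_exp_smul_const' (𝕂 := ℝ) L x).mul_const (NormedSpace.exp M)
  simpa [mul_assoc] using this

noncomputable def absD (A : 𝔸) (x t : ℝ) : 𝔸 := NormedSpace.exp ((2 * x) • A - (8 * t) • A ^ 3)
noncomputable def absD' (A : 𝔸) (x t : ℝ) : 𝔸 := NormedSpace.exp (-((2 * x) • A) + (8 * t) • A ^ 3)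

theorem absD_comm (A : 𝔸) (x t : ℝ) : A * absD A x t = absD A x t * A := by
  have : Commute A ((2 * x) • A - (8 * t) • A ^ 3) :=
    ((Commute.refl A).smul_right _).sub_right (((Commute.refl A).pow_right 3).smul_right _)
  exact (this.exp_right).eq

theorem absD'_comm (A : 𝔸) (x t : ℝ) : A * absD' A x t = absD' A x t * A := by
  have : Commute A (-((2 * x) • A) + (8 * t) • A ^ 3) :=
    (((Commute.refl A).smul_right _).neg_right).add_right
      (((Commute.refl A).pow_right 3).smul_right _)
  exact (this.exp_right).eq

theorem absD_mul (A : 𝔸) (x t : ℝ) : absD A x t * absD' A x t = 1 := by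
  let _ : NormedAlgebra ℚ 𝔸 := NormedAlgebra.restrictScalars ℚ ℝ 𝔸
  have : -((2 * x) • A) + (8 * t) • A ^ 3 = -((2 * x) • A - (8 * t) • A ^ 3) := by abel
  rw [absD, absD', this, ← NormedSpace.exp_add_of_commute ((Commute.refl _).neg_right)]
  simp

theorem absD'_mul (A : 𝔸) (x t : ℝ) : absD' A x t * absD A x t = 1 := by
  let _ : NormedAlgebra ℚ 𝔸 := NormedAlgebra.restrictScalars ℚ ℝ 𝔸
  have : -((2 * x) • A) + (8 * t) • A ^ 3 = -((2 * x) • A - (8 * t) • A ^ 3) := by abel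
  rw [absD, absD', this, ← NormedSpace.exp_add_of_commute ((Commute.refl _).neg_left)]
  simp

theorem absD_dx (A : 𝔸) (x t : ℝ) :
    HasDerivAt (fun y => absD A y t) ((2:ℝ) • (A * absD A x t)) x := by
  have h := abs_hasDerivAt_exp_aux ((2:ℝ) • A) (-((8 * t) • A ^ 3))
    ((((Commute.refl A).pow_right 3).smul_left _).smul_right _).neg_right x
  have e : ∀ y : ℝ, (2 * y) • A - (8 * t) • A ^ 3 = y • (2:ℝ) • A + -((8 * t) • A ^ 3) := by
    intro y; rw [smul_smul, mul_comm, sub_eq_add_neg]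
  simp only [absD, e]
  simpa using h

theorem absD'_dx (A : 𝔸) (x t : ℝ) :
    HasDerivAt (fun y => absD' A y t) ((-2:ℝ) • (A * absD' A x t)) x := by
  have h := abs_hasDerivAt_exp_aux ((-2:ℝ) • A) (((8 * t) • A ^ 3))
    ((((Commute.refl A).pow_right 3).smul_left _).smul_right _) x
  have e : ∀ y : ℝ, -((2 * y) • A) + (8 * t) • A ^ 3 = y • (-2:ℝ) • A + ((8 * t) • A ^ 3) := by
    intro y; rw [smul_smul, mul_comm 2 y, mul_neg, neg_smul]
  simp only [absD', e]
  simpa using h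

theorem absD_dt (A : 𝔸) (x t : ℝ) :
    HasDerivAt (fun y => absD A x y) ((-8:ℝ) • (A ^ 3 * absD A x t)) t := by
  have h := abs_hasDerivAt_exp_aux ((-8:ℝ) • A ^ 3) ((2 * x) • A)
    ((((Commute.refl A).pow_left 3).smul_left _).smul_right _) t
  have e : ∀ y : ℝ, (2 * x) • A - (8 * y) • A ^ 3 = y • (-8:ℝ) • A ^ 3 + (2 * x) • A := by
    intro y; rw [smul_smul, mul_comm 8 y, mul_neg, neg_smul]; abel
  simp only [absD, e]
  simpa using h

theorem absD'_dt (A : 𝔸) (x t : ℝ) :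
    HasDerivAt (fun y => absD' A x y) ((8:ℝ) • (A ^ 3 * absD' A x t)) t := by
  have h := abs_hasDerivAt_exp_aux ((8:ℝ) • A ^ 3) (-((2 * x) • A))
    ((((Commute.refl A).pow_left 3).smul_left _).smul_right _).neg_right t
  have e : ∀ y : ℝ, -((2 * x) • A) + (8 * y) • A ^ 3 = y • (8:ℝ) • A ^ 3 + -((2 * x) • A) := by
    intro y; rw [smul_smul, mul_comm 8 y]; abel
  simp only [absD', e]
  simpa using h

theorem abs_inv_deriv (f : ℝ → 𝔸) (f' : 𝔸) (x : ℝ) (hf : HasDerivAt f f' x)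
    (hu : IsUnit (f x)) :
    HasDerivAt (fun y => Ring.inverse (f y)) (-(Ring.inverse (f x) * f' * Ring.inverse (f x))) x := by
  obtain ⟨u, hu⟩ := hu
  have h1 := hasFDerivAt_ringInverse (𝕜 := ℝ) u
  rw [hu] at h1
  have := h1.comp_hasDerivAt x hf
  refine HasDerivAt.congr_deriv (f' := _) this ?_
  rw [← hu, Ring.inverse_unit]
  simp [mul_assoc]

noncomputable def absE (A P : 𝔸) (x t : ℝ) : 𝔸 := absD A x t + P * absD' A x t * P

/-- purely algebraic relations -/
theorem abs_alg {R : Type*} [Ring R] (A P K D D' G : R) (hS : A * P + P * A = K)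
    (hD : A * D = D * A) (hD' : A * D' = D' * A) (h1 : D * D' = 1) (h2 : D' * D = 1)
    (hG1 : (D + P * D' * P) * G = 1) (hG2 : G * (D + P * D' * P) = 1) :
    D' * P * G = G * P * D' ∧
    G * A = A * G + G * K * (D' * P * G) - (D' * P * G) * K * G ∧
    A * (D' * P * G) + (D' * P * G) * A = G * K * G + (D' * P * G) * K * (D' * P * G) := by
  have c1 : D' * P * G = G * P * D' := by
    have e : (D + P * D' * P) * (D' * P) = P * D' * (D + P * D' * P) := by
      have : (D + P * D' * P) * (D' * P) = (D * D') * P + P * D' * P * D' * P := by noncomm_ring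
      rw [this, h1]
      have : P * D' * (D + P * D' * P) = P * (D' * D) + P * D' * P * D' * P := by noncomm_ring
      rw [this, h2]; noncomm_ring
    calc D' * P * G = (G * (D + P * D' * P)) * (D' * P) * G := by rw [hG2, one_mul]
      _ = G * ((D + P * D' * P) * (D' * P)) * G := by noncomm_ring
      _ = G * P * D' * ((D + P * D' * P) * G) := by rw [e]; noncomm_ring
      _ = _ := by rw [hG1, mul_one]
  have c2 : G * A = A * G + G * K * (D' * P * G) - (D' * P * G) * K * G := by
    have e : A * (D + P * D' * P) = (D + P * D' * P) * A + K * D' * P - P * D' * K := by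
      rw [← hS]
      have : (D + P * D' * P) * A + (A * P + P * A) * D' * P - P * D' * (A * P + P * A)
        = D * A + A * P * D' * P + P * (A * D') * P - P * (D' * A) * P := by noncomm_ring
      rw [this, hD', ← hD]; noncomm_ring
    calc G * A = G * (A * (D + P * D' * P)) * G := by
            rw [mul_assoc, mul_assoc A, hG1, mul_one]
      _ = (G * (D + P * D' * P)) * A * G + G * K * (D' * P * G) - (G * P * D') * K * G := by
            rw [e]; noncomm_ring
      _ = _ := by rw [hG2, one_mul, ← c1]
  refine ⟨c1, c2, ?_⟩
  have c3 : D' - D' * P * (D' * P * G) = G := by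
    calc D' - D' * P * (D' * P * G) = D' * ((D + P * D' * P) * G) - D' * P * (D' * P * G) := by
            rw [hG1, mul_one]
      _ = (D' * D) * G := by noncomm_ring
      _ = G := by rw [h2, one_mul]
  calc A * (D' * P * G) + (D' * P * G) * A 
      = (A * D') * P * G + D' * P * (G * A) := by noncomm_ring
    _ = D' * (A * P + P * A) * G  + D' * P * (G * K * (D' * P * G) - (D' * P * G) * K * G) := by
        rw [hD', c2]; noncomm_ring
    _ = (D' - D' * P * (D' * P * G)) * K * G + (D' * P * G) * K * (D' * P * G) := by
        rw [hS]; noncomm_ring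
    _ = _ := by rw [c3]

theorem abs_main (A P K : 𝔸) (hS : A * P + P * A = K) (φ : 𝔸 →L[ℝ] ℝ)
    (hφ : ∀ M N, φ (M * K * N) = φ M * φ N) (hE : ∀ x t, IsUnit (absE A P x t)) (x t : ℝ) :
    deriv (fun τ : ℝ => -2 * φ (Ring.inverse (absE A P x τ))) t
        + iteratedDeriv 3 (fun ξ : ℝ => -2 * φ (Ring.inverse (absE A P ξ t))) x
        + 6 * (-2 * φ (Ring.inverse (absE A P x t))) ^ 2 *
          deriv (fun ξ : ℝ => -2 * φ (Ring.inverse (absE A P ξ t))) x = 0 := by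
  set G : ℝ → ℝ → 𝔸 := fun x t => Ring.inverse (absE A P x t) with hG
  set H : ℝ → ℝ → 𝔸 := fun x t => absD' A x t * P * G x t with hH
  have G1 : ∀ x t, absE A P x t * G x t = 1 := fun x t => Ring.mul_inverse_cancel _ (hE x t)
  have G2 : ∀ x t, G x t * absE A P x t = 1 := fun x t => Ring.inverse_mul_cancel _ (hE x t)
  have alg := fun x t => abs_alg A P K (absD A x t) (absD' A x t) (G x t) hS (absD_comm A x t)
    (absD'_comm A x t) (absD_mul A x t) (absD'_mul A x t) (G1 x t) (G2 x t)
  have Gx : ∀ x t, HasDerivAt (fun y => G y t)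
      ((-2:ℝ) • (G x t * A) + (2:ℝ) • (G x t * K * H x t)) x := by
    intro x t
    have hEx : HasDerivAt (fun y => absE A P y t)
        ((2:ℝ) • (A * absD A x t) + P * ((-2:ℝ) • (A * absD' A x t)) * P) x :=
      (absD_dx A x t).add (((absD'_dx A x t).const_mul P).mul_const P)
    convert abs_inv_deriv _ _ x hEx (hE x t) using 1
    have e : (2:ℝ) • (A * absD A x t) + P * ((-2:ℝ) • (A * absD' A x t)) * P
      = (2:ℝ) • (A * absE A P x t) - (2:ℝ) • (K * absD' A x t * P) := by
      rw [absE, ← hS]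
      simp only [mul_smul_comm, smul_mul_assoc, mul_add, add_mul, smul_add, neg_smul, mul_neg, neg_mul, mul_assoc]
      abel
    rw [e]
    change _ = -(G x t * _ * G x t)
    have : G x t * ((2:ℝ) • (A * absE A P x t) - (2:ℝ) • (K * absD' A x t * P)) * G x t
      = (2:ℝ) • (G x t * A * (absE A P x t * G x t)) - (2:ℝ) • (G x t * K * H x t) := by
      simp only [hH, mul_smul_comm, smul_mul_assoc, mul_sub, sub_mul, mul_assoc]
    rw [this, G1, mul_one, neg_smul]; abel
  have Hx : ∀ x t, HasDerivAt (fun y => H y t) ((-2:ℝ) • (G x t * K * G x t)) x := by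
    intro x t
    have h := ((absD'_dx A x t).mul_const P).mul (Gx x t)
    refine HasDerivAt.congr_deriv (f' := _) h ?_
    have a3 := (alg x t).2.2
    change A * H x t + H x t * A = G x t * K * G x t + H x t * K * H x t at a3
    have : G x t * K * G x t = A * H x t + H x t * A - H x t * K * H x t := by rw [a3]; abel
    rw [this]
    change _ * G x t + _ = _
    simp only [hH, mul_smul_comm, smul_mul_assoc, mul_add, mul_sub, smul_add, smul_sub, neg_smul, mul_neg, neg_mul, mul_assoc]
    abel
  have Gt : ∀ x t, HasDerivAt (fun y => G x y)
      ((8:ℝ) • (G x t * A ^ 3) - (8:ℝ) • (G x t * (A ^ 2 * K - A * K * A + K * A ^ 2) * H x t)) t := by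
    intro x t
    have hEt : HasDerivAt (fun y => absE A P x y)
        ((-8:ℝ) • (A ^ 3 * absD A x t) + P * ((8:ℝ) • (A ^ 3 * absD' A x t)) * P) t :=
      (absD_dt A x t).add (((absD'_dt A x t).const_mul P).mul_const P)
    convert abs_inv_deriv _ _ t hEt (hE x t) using 1
    have e : (-8:ℝ) • (A ^ 3 * absD A x t) + P * ((8:ℝ) • (A ^ 3 * absD' A x t)) * P
      = (-8:ℝ) • (A ^ 3 * absE A P x t)
        + (8:ℝ) • ((A ^ 2 * K - A * K * A + K * A ^ 2) * absD' A x t * P) := by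
      have : A ^ 2 * K - A * K * A + K * A ^ 2 = A ^ 3 * P + P * A ^ 3 := by
        rw [← hS]; noncomm_ring
      rw [absE, this]
      simp only [mul_smul_comm, smul_mul_assoc, mul_add, add_mul, smul_add, neg_smul, mul_neg, neg_mul, mul_assoc]
      abel
    rw [e]
    change _ = -(G x t * _ * G x t)
    generalize (A ^ 2 * K - A * K * A + K * A ^ 2) = J
    have : G x t * ((-8:ℝ) • (A ^ 3 * absE A P x t) + (8:ℝ) • (J * absD' A x t * P)) * G x t
      = (-8:ℝ) • (G x t * A ^ 3 * (absE A P x t * G x t)) + (8:ℝ) • (G x t * J * H x t) := by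
      simp only [hH, mul_smul_comm, smul_mul_assoc, mul_add, add_mul, mul_assoc]
    rw [this, G1, mul_one, neg_smul]; abel
  -- scalar functions
  set a : ℕ → ℝ → ℝ → ℝ := fun k x t => φ (G x t * A ^ k) with ha
  set b : ℕ → ℝ → ℝ → ℝ := fun k x t => φ (H x t * A ^ k) with hb
  have hφ2 : ∀ M N k, φ (M * K * N * A ^ k) = φ M * φ (N * A ^ k) := by
    intro M N k; rw [mul_assoc, hφ]
  have hφ3 : ∀ M N k, φ (M * (K * (N * A ^ k))) = φ M * φ (N * A ^ k) := by
    intro M N k; rw [← mul_assoc, hφ]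
  have ax : ∀ k x t, HasDerivAt (fun y => a k y t)
      (-2 * a (k+1) x t + 2 * a 0 x t * b k x t) x := by
    intro k x t
    have h := φ.hasFDerivAt.comp_hasDerivAt x ((Gx x t).mul_const (A ^ k))
    refine HasDerivAt.congr_deriv (f' := _) h ?_
    simp only [ha, hb, add_mul, smul_mul_assoc, map_add, map_smul, smul_eq_mul, hφ3, pow_zero,
      mul_one, pow_succ', mul_assoc]
  have bx : ∀ k x t, HasDerivAt (fun y => b k y t) (-2 * a 0 x t * a k x t) x := by
    intro k x t
    have h := φ.hasFDerivAt.comp_hasDerivAt x ((Hx x t).mul_const (A ^ k))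
    refine HasDerivAt.congr_deriv (f' := _) h ?_
    simp only [ha, smul_mul_assoc, map_smul, smul_eq_mul, hφ3, pow_zero, mul_one, mul_assoc]
  have at' : HasDerivAt (fun y => a 0 x y)
      (8 * a 3 x t - 8 * (a 2 x t * b 0 x t - a 1 x t * φ (A * H x t)
        + a 0 x t * φ (A ^ 2 * H x t))) t := by
    have h := φ.hasFDerivAt.comp_hasDerivAt t (Gt x t)
    have h0 : (fun y => a 0 x y) = (φ ∘ fun y => G x y) := by
      funext y; simp [ha]
    rw [h0]
    refine HasDerivAt.congr_deriv (f' := _) h ?_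
    have e : G x t * (A ^ 2 * K - A * K * A + K * A ^ 2) * H x t
      = (G x t * A ^ 2) * K * H x t - (G x t * A) * K * (A * H x t)
        + G x t * K * (A ^ 2 * H x t) := by noncomm_ring
    rw [e]
    simp only [ha, hb, map_add, map_sub, map_smul, smul_eq_mul, hφ, pow_zero, mul_one, pow_one]
  have g0 : φ (A * G x t) = a 1 x t := by
    have := congrArg φ (alg x t).2.1
    change φ (G x t * A) = φ (A * G x t + G x t * K * H x t - H x t * K * G x t) at this
    simp only [map_add, map_sub, hφ] at this
    simp only [ha, pow_one]; linarith
  have a3 := (alg x t).2.2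
  change A * H x t + H x t * A = G x t * K * G x t + H x t * K * H x t at a3
  have g1 : φ (A * H x t) = -b 1 x t + a 0 x t ^ 2 + b 0 x t ^ 2 := by
    have := congrArg φ a3
    simp only [map_add, hφ] at this
    simp only [ha, hb, pow_one, pow_zero, mul_one]; linarith
  have g11 : φ (A * H x t * A) = -b 2 x t + a 0 x t * a 1 x t + b 0 x t * b 1 x t := by
    have := congrArg φ (congrArg (· * A) a3)
    have e1 := hφ2 (G x t) (G x t) 1
    have e2 := hφ2 (H x t) (H x t) 1
    simp only [pow_one] at e1 e2
    simp only [add_mul, map_add, e1, e2] at this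
    simp only [ha, hb, pow_one, pow_zero, mul_one, pow_two, ← mul_assoc]; linarith
  have g2 : φ (A ^ 2 * H x t) = b 2 x t - 2 * b 0 x t * b 1 x t
      + b 0 x t * (a 0 x t ^ 2 + b 0 x t ^ 2) := by
    have := congrArg φ (congrArg (A * ·) a3)
    have e : A * (G x t * K * G x t + H x t * K * H x t)
      = (A * G x t) * K * G x t + (A * H x t) * K * H x t := by noncomm_ring
    have e' : A * (A * H x t + H x t * A) = A ^ 2 * H x t + A * H x t * A := by noncomm_ring
    simp only [e, e', map_add, hφ, g0, g1, g11] at this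
    have h1 : φ (G x t) = a 0 x t := by simp [ha]
    have h2 : φ (H x t) = b 0 x t := by simp [hb]
    rw [h1, h2] at this
    linear_combination this
  have v0 : ∀ x t, φ (G x t) = a 0 x t := by intro x t; simp [ha]
  change deriv (fun τ : ℝ => -2 * φ (G x τ)) t + iteratedDeriv 3 (fun ξ : ℝ => -2 * φ (G ξ t)) x
    + 6 * (-2 * φ (G x t)) ^ 2 * deriv (fun ξ : ℝ => -2 * φ (G ξ t)) x = 0
  simp only [v0]
  have d1 : deriv (fun ξ : ℝ => -2 * a 0 ξ t)
      = fun ξ => -2 * (-2 * a 1 ξ t + 2 * a 0 ξ t * b 0 ξ t) := by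
    funext ξ; exact ((ax 0 ξ t).const_mul (-2)).deriv
  have d2 : deriv (fun ξ => -2 * (-2 * a 1 ξ t + 2 * a 0 ξ t * b 0 ξ t))
      = fun ξ => -2 * (4 * a 2 ξ t - 4 * a 0 ξ t * b 1 ξ t - 4 * a 1 ξ t * b 0 ξ t
        + 4 * a 0 ξ t * b 0 ξ t ^ 2 - 4 * a 0 ξ t ^ 3) := by
    funext ξ
    have := ((((ax 1 ξ t).const_mul (-2)).add
      (((ax 0 ξ t).const_mul 2).mul (bx 0 ξ t))).const_mul (-2)).deriv
    refine Eq.trans this ?_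
    ring
  have d3 := ((((((((ax 2 x t).const_mul 4).sub (((ax 0 x t).const_mul 4).mul (bx 1 x t))).sub
      (((ax 1 x t).const_mul 4).mul (bx 0 x t))).add
      (((ax 0 x t).const_mul 4).mul ((bx 0 x t).pow 2)))).sub
      (((ax 0 x t).pow 3).const_mul 4)).const_mul (-2)).deriv
  rw [iteratedDeriv_succ, iteratedDeriv_succ, iteratedDeriv_one, d1, d2]
  have d3' := Eq.trans (show deriv (fun ξ => -2 * (4 * a 2 ξ t - 4 * a 0 ξ t * b 1 ξ t - 4 * a 1 ξ t * b 0 ξ t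
        + 4 * a 0 ξ t * b 0 ξ t ^ 2 - 4 * a 0 ξ t ^ 3)) x = _ from rfl) d3
  rw [d3', (at'.const_mul (-2)).deriv, g1, g2]
  simp only [Pi.pow_apply, Nat.cast_ofNat, Nat.reduceSub, pow_one, Nat.reduceAdd]
  ring
end abs

section decay

theorem mexp_eq {p : ℕ} (M : Matrix (Fin p) (Fin p) ℝ) : mexp M = NormedSpace.exp M := by
  rw [NormedSpace.exp_eq_tsum ℝ]; rfl

def Dec {F : Type*} [NormedField F] (f : ℝ → F) : Prop :=
  ∃ δ : ℝ, 0 < δ ∧ f =O[atTop] (fun s => Real.exp (-δ * s))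

variable {F : Type*} [NormedField F]

theorem Dec.mono_exp {f : ℝ → F} {δ ε : ℝ} (h : f =O[atTop] (fun s => Real.exp (-δ * s)))
    (he : ε ≤ δ) : f =O[atTop] (fun s => Real.exp (-ε * s)) := by
  refine h.trans (Asymptotics.IsBigO.of_bound 1 ?_)
  filter_upwards [eventually_ge_atTop 0] with s hs
  simp only [Real.norm_eq_abs, Real.abs_exp, one_mul]
  apply Real.exp_le_exp.2
  nlinarith

theorem Dec.add {f g : ℝ → F} (hf : Dec f) (hg : Dec g) : Dec (fun s => f s + g s) := by
  obtain ⟨δ, hδ, hf⟩ := hf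
  obtain ⟨ε, hε, hg⟩ := hg
  exact ⟨min δ ε, lt_min hδ hε, (Dec.mono_exp hf (min_le_left _ _)).add
    (Dec.mono_exp hg (min_le_right _ _))⟩

theorem Dec.zero : Dec (fun _ : ℝ => (0 : F)) := ⟨1, one_pos, Asymptotics.isBigO_zero _ _⟩

theorem Dec.const_mul {f : ℝ → F} (hf : Dec f) (c : F) : Dec (fun s => c * f s) := by
  obtain ⟨δ, hδ, hf⟩ := hf
  exact ⟨δ, hδ, hf.const_mul_left c⟩

theorem Dec.mul {f g : ℝ → F} (hf : Dec f) (hg : Dec g) : Dec (fun s => f s * g s) := by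
  obtain ⟨δ, hδ, hf⟩ := hf
  obtain ⟨ε, hε, hg⟩ := hg
  refine ⟨δ + ε, add_pos hδ hε, ?_⟩
  refine (hf.mul hg).congr_right ?_
  intro s; rw [← Real.exp_add]; ring_nf

theorem Dec.sum {ι : Type*} (S : Finset ι) (f : ι → ℝ → F) (h : ∀ i ∈ S, Dec (f i)) :
    Dec (fun s => ∑ i ∈ S, f i s) := by
  classical
  induction S using Finset.induction_on with
  | empty => simpa using Dec.zero
  | insert a S ha ih =>
    simp only [Finset.sum_insert ha]
    exact (h a (Finset.mem_insert_self _ _)).add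
      (ih fun i hi => h i (Finset.mem_insert_of_mem hi))

theorem exp_mulVec_nilp {p : ℕ} (M : Matrix (Fin p) (Fin p) ℂ) (v : Fin p → ℂ) (K : ℕ)
    (h : M ^ K *ᵥ v = 0) (i : Fin p) :
    (NormedSpace.exp M *ᵥ v) i
      = ∑ k ∈ Finset.range K, ((k.factorial : ℂ)⁻¹ * (M ^ k *ᵥ v) i) := by
  have hs : HasSum (fun k : ℕ => ((k.factorial : ℂ)⁻¹ • M ^ k)) (NormedSpace.exp M) := by
    open scoped Matrix.Norms.Operator in
    exact NormedSpace.exp_series_hasSum_exp' (𝕂 := ℂ) M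
  let f : Matrix (Fin p) (Fin p) ℂ →+ ℂ :=
    { toFun := fun M => (M *ᵥ v) i, map_zero' := by simp, map_add' := by simp [add_mulVec] }
  have hf : Continuous f := by
    change Continuous (fun M : Matrix (Fin p) (Fin p) ℂ => (M *ᵥ v) i)
    fun_prop
  have h1 := hs.map f hf
  have h2 : HasSum (f ∘ fun k : ℕ => ((k.factorial : ℂ)⁻¹ • M ^ k))
      (∑ k ∈ Finset.range K, (f ∘ fun k : ℕ => ((k.factorial : ℂ)⁻¹ • M ^ k)) k) := by
    apply hasSum_sum_of_ne_finset_zero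
    intro k hk
    have : K ≤ k := by simpa using hk
    obtain ⟨m, rfl⟩ := Nat.exists_eq_add_of_le this
    have : M ^ (K + m) *ᵥ v = 0 := by
      rw [add_comm, pow_add, ← mulVec_mulVec, h, mulVec_zero]
    change ((((K + m).factorial : ℂ)⁻¹ • M ^ (K + m)) *ᵥ v) i = 0
    rw [smul_mulVec, this]; simp
  have h3 := h1.unique h2
  change (NormedSpace.exp M *ᵥ v) i = _ at h3
  rw [h3]
  refine Finset.sum_congr rfl fun k _ => ?_
  change (((k.factorial : ℂ)⁻¹ • M ^ k) *ᵥ v) i = _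
  rw [smul_mulVec]; simp

theorem dec_pow_exp (μ : ℂ) (hμ : 0 < μ.re) (k : ℕ) :
    Dec (fun s : ℝ => Complex.exp (-(s * μ)) * (-(s : ℂ)) ^ k) := by
  refine ⟨μ.re / 2, by linarith, ?_⟩
  have h := (isLittleO_pow_exp_pos_mul_atTop k (b := μ.re / 2) (by linarith)).isBigO
  have h2 := (Asymptotics.isBigO_refl (fun s : ℝ => Real.exp (-μ.re * s)) atTop).mul h
  refine Asymptotics.IsBigO.trans (Asymptotics.IsBigO.of_norm_eventuallyLE (g := fun s : ℝ => ‖Real.exp (-μ.re * s) * s ^ k‖) ?_) (h2.norm_left.congr_right ?_)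
  · filter_upwards with s
    simp [Complex.norm_exp, mul_comm]
  · intro s; rw [← Real.exp_add]; ring_nf

theorem decC {p : ℕ} (A : Matrix (Fin p) (Fin p) ℂ) (hA : ∀ μ ∈ spectrum ℂ A, 0 < μ.re)
    (v : Fin p → ℂ) (i : Fin p) :
    Dec (fun s : ℝ => (NormedSpace.exp (-((s : ℂ) • A)) *ᵥ v) i) := by
  let W : Submodule ℂ (Fin p → ℂ) :=
    { carrier := {v | ∀ i, Dec (fun s : ℝ => (NormedSpace.exp (-((s : ℂ) • A)) *ᵥ v) i)}
      add_mem' := by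
        intro v w hv hw i
        simpa [mulVec_add] using (hv i).add (hw i)
      zero_mem' := by
        intro i
        simpa using Dec.zero
      smul_mem' := by
        intro c v hv i
        simpa [mulVec_smul] using (hv i).const_mul c }
  suffices W = ⊤ by
    have h : v ∈ W := this ▸ Submodule.mem_top
    exact h i
  rw [eq_top_iff, ← Module.End.iSup_maxGenEigenspace_eq_top (Matrix.toLin' A)]
  refine iSup_le fun μ v hv => ?_
  rw [Module.End.mem_maxGenEigenspace] at hv
  obtain ⟨K, hK⟩ := hv
  set N : Matrix (Fin p) (Fin p) ℂ := A - μ • 1 with hN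
  have hK' : N ^ K *ᵥ v = 0 := by
    have : Matrix.toLin' A - μ • 1 = Matrix.toLin' N := by
      rw [hN, map_sub, map_smul, Matrix.toLin'_one]; rfl
    rw [this, ← Matrix.toLin'_pow] at hK
    rw [Matrix.toLin'_apply] at hK; exact hK
  by_cases hμ : μ ∈ spectrum ℂ A
  · intro i
    have e : ∀ s : ℝ, (NormedSpace.exp (-((s : ℂ) • A)) *ᵥ v) i
        = ∑ k ∈ Finset.range K, ((k.factorial : ℂ)⁻¹ * (N ^ k *ᵥ v) i) *
          (Complex.exp (-(s * μ)) * (-(s : ℂ)) ^ k) := by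
      intro s
      have h1 : -((s : ℂ) • A) = diagonal (fun _ => (-(s * μ) : ℂ)) + (-(s : ℂ)) • N := by
        rw [← smul_one_eq_diagonal, hN, smul_sub, smul_smul]
        simp
      have hc : Commute (diagonal (fun _ : Fin p => (-(s * μ) : ℂ))) ((-(s : ℂ)) • N) := by
        rw [← smul_one_eq_diagonal]
        exact (Commute.one_left _).smul_left _
      rw [h1, Matrix.exp_add_of_commute _ _ hc, Matrix.exp_diagonal, ← mulVec_mulVec, mulVec_diagonal,
        Pi.coe_exp, ← Complex.exp_eq_exp_ℂ,
        exp_mulVec_nilp _ v K (by rw [smul_pow, smul_mulVec, hK', smul_zero]), Finset.mul_sum]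
      refine Finset.sum_congr rfl fun k _ => ?_
      rw [smul_pow, smul_mulVec, Pi.smul_apply, smul_eq_mul]; ring
    simp only [e]
    exact Dec.sum _ _ fun k _ => (dec_pow_exp μ (hA μ hμ) k).const_mul _
  · have : IsUnit N := by
      have := spectrum.notMem_iff.1 hμ
      rw [← IsUnit.neg_iff] at this
      convert this using 1
      rw [hN, Algebra.algebraMap_eq_smul_one]; abel
    have h2 : IsUnit (N ^ K) := this.pow K
    have : v = 0 := by
      have hinj := Matrix.mulVec_injective_of_isUnit h2
      exact hinj (by rw [hK', mulVec_zero])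
    rw [this]; exact W.zero_mem

theorem decR {p : ℕ} (A : Matrix (Fin p) (Fin p) ℝ) (hA : EigPos A) (i j : Fin p) :
    Dec (fun s : ℝ => mexp (-(s • A)) i j) := by
  obtain ⟨δ, hδ, h⟩ := decC (A.map Complex.ofReal) hA (Pi.single j 1) i
  refine ⟨δ, hδ, ?_⟩
  refine (Asymptotics.IsBigO.of_norm_left (h.norm_left.congr_left ?_))
  intro s
  have e : (mexp (-(s • A))).map Complex.ofReal
      = NormedSpace.exp (-((s : ℂ) • A.map Complex.ofReal)) := by
    have : -((s : ℂ) • A.map Complex.ofReal) = Complex.ofRealHom.mapMatrix (-(s • A)) := by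
      ext i j; simp
    rw [mexp_eq, this]
    have hc : Continuous (Complex.ofRealHom.mapMatrix (m := Fin p)) := by
      change Continuous (fun M : Matrix (Fin p) (Fin p) ℝ => M.map Complex.ofReal)
      exact continuous_id.matrix_map Complex.continuous_ofReal
    open scoped Matrix.Norms.Operator in
    exact NormedSpace.map_exp (Complex.ofRealHom.mapMatrix (m := Fin p)) hc (-(s • A))
  rw [← e]
  simp
end decay

section intg
variable {p : ℕ}

theorem mexp_transpose (M : Matrix (Fin p) (Fin p) ℝ) : mexp Mᵀ = (mexp M)ᵀ := by
  rw [mexp_eq, mexp_eq, Matrix.exp_transpose]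

theorem mexp_isUnit (M : Matrix (Fin p) (Fin p) ℝ) : IsUnit (mexp M) := by
  rw [mexp_eq]; exact Matrix.isUnit_exp M

theorem mexp_neg_mul (M : Matrix (Fin p) (Fin p) ℝ) : mexp M * mexp (-M) = 1 := by
  rw [mexp_eq, mexp_eq, ← Matrix.exp_add_of_commute _ _ ((Commute.refl M).neg_right)]
  simp

def DecM (L : Matrix (Fin p) (Fin p) ℝ) : Prop := ∀ i j, Dec (fun s : ℝ => mexp (-(s • L)) i j)

theorem decM_transpose {L : Matrix (Fin p) (Fin p) ℝ} (h : DecM L) : DecM Lᵀ := by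
  intro i j
  have : ∀ s : ℝ, mexp (-(s • Lᵀ)) i j = mexp (-(s • L)) j i := by
    intro s
    rw [← transpose_smul, ← transpose_neg, mexp_transpose]; rfl
  simp only [this]; exact h j i

noncomputable def fI (L M R : Matrix (Fin p) (Fin p) ℝ) (s : ℝ) : Matrix (Fin p) (Fin p) ℝ :=
  mexp (-(s • L)) * M * mexp (-(s • R))

open scoped Matrix.Norms.Operator in
theorem fI_deriv (L M R : Matrix (Fin p) (Fin p) ℝ) (i j : Fin p) (s : ℝ) :
    HasDerivAt (fun s => fI L M R s i j) (-((L * fI L M R s) i j + (fI L M R s * R) i j)) s := by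
  have h : ∀ L : Matrix (Fin p) (Fin p) ℝ,
      HasDerivAt (fun s : ℝ => mexp (-(s • L))) (-L * mexp (-(s • L))) s := by
    intro L
    have := abs_hasDerivAt_exp_aux (-L) 0 (Commute.zero_right _) s
    have e : (fun s : ℝ => mexp (-(s • L))) = fun s : ℝ => NormedSpace.exp (s • (-L) + 0) := by
      funext s; rw [mexp_eq, add_zero, smul_neg]
    have e2 : mexp (-(s • L)) = NormedSpace.exp (s • (-L) + 0) := by
      rw [mexp_eq, add_zero, smul_neg]
    rw [e, e2]
    exact this
  have hc : mexp (-(s • R)) * R = R * mexp (-(s • R)) := by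
    rw [mexp_eq]
    exact ((((Commute.refl R).smul_right s).neg_right).exp_right).eq.symm
  have h2 := ((h L).mul_const M).mul (h R)
  let ψ : Matrix (Fin p) (Fin p) ℝ →L[ℝ] ℝ :=
    LinearMap.toContinuousLinearMap (Matrix.entryLinearMap ℝ ℝ i j)
  have h3 := ψ.hasFDerivAt.comp_hasDerivAt s h2
  refine HasDerivAt.congr_deriv (f' := _) h3 ?_
  change (-L * mexp (-(s • L)) * M * mexp (-(s • R)) +
    mexp (-(s • L)) * M * (-R * mexp (-(s • R)))) i j = _
  rw [← Matrix.add_apply, ← Matrix.neg_apply]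
  have hX : (-L * mexp (-(s • L)) * M * mexp (-(s • R)) +
    mexp (-(s • L)) * M * (-R * mexp (-(s • R)))) = -(L * fI L M R s + fI L M R s * R) := by
    rw [fI, Matrix.mul_assoc _ _ R, hc]
    noncomm_ring
  rw [hX]

theorem fI_cont (L M R : Matrix (Fin p) (Fin p) ℝ) (i j : Fin p) :
    Continuous (fun s => fI L M R s i j) :=
  continuous_iff_continuousAt.2 fun s => (fI_deriv L M R i j s).continuousAt

theorem fI_dec {L R : Matrix (Fin p) (Fin p) ℝ} (hL : DecM L) (hR : DecM R)
    (M : Matrix (Fin p) (Fin p) ℝ) (i j : Fin p) : Dec (fun s => fI L M R s i j) := by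
  simp only [fI, Matrix.mul_apply]
  refine Dec.sum _ _ fun k _ => Dec.mul (Dec.sum _ _ fun l _ => ?_) (hR k j)
  simpa [mul_comm] using (hL i l).const_mul (M l k)

theorem fI_int {L R : Matrix (Fin p) (Fin p) ℝ} (hL : DecM L) (hR : DecM R)
    (M : Matrix (Fin p) (Fin p) ℝ) (i j : Fin p) :
    IntegrableOn (fun s => fI L M R s i j) (Set.Ioi 0) := by
  obtain ⟨δ, hδ, h⟩ := fI_dec hL hR M i j
  exact integrable_of_isBigO_exp_neg hδ (fI_cont L M R i j).continuousOn h

theorem Dec.tendsto {f : ℝ → ℝ} (h : Dec f) : Tendsto f atTop (nhds 0) := by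
  obtain ⟨δ, hδ, h⟩ := h
  refine h.trans_tendsto ?_
  refine Real.tendsto_exp_atBot.comp ?_
  exact tendsto_id.const_mul_atTop_of_neg (by linarith)

noncomputable def Imat (f : ℝ → Matrix (Fin p) (Fin p) ℝ) : Matrix (Fin p) (Fin p) ℝ :=
  Matrix.of fun i j => ∫ s in Set.Ioi (0 : ℝ), f s i j

theorem Imat_mul_left (X : Matrix (Fin p) (Fin p) ℝ) (f : ℝ → Matrix (Fin p) (Fin p) ℝ)
    (hf : ∀ i j, IntegrableOn (fun s => f s i j) (Set.Ioi 0)) :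
    X * Imat f = Imat (fun s => X * f s) := by
  ext i j
  simp only [Imat, Matrix.mul_apply, Matrix.of_apply]
  rw [integral_finset_sum _ fun k _ => (hf k j).const_mul (X i k)]
  simp only [integral_const_mul]

theorem Imat_mul_right (X : Matrix (Fin p) (Fin p) ℝ) (f : ℝ → Matrix (Fin p) (Fin p) ℝ)
    (hf : ∀ i j, IntegrableOn (fun s => f s i j) (Set.Ioi 0)) :
    Imat f * X = Imat (fun s => f s * X) := by
  ext i j
  simp only [Imat, Matrix.mul_apply, Matrix.of_apply]
  rw [integral_finset_sum _ fun k _ => (hf i k).mul_const (X k j)]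
  simp only [integral_mul_const]

theorem sylvester {L R : Matrix (Fin p) (Fin p) ℝ} (hL : DecM L) (hR : DecM R)
    (M : Matrix (Fin p) (Fin p) ℝ) :
    L * Imat (fI L M R) + Imat (fI L M R) * R = M := by
  have hf := fI_int hL hR M
  rw [Imat_mul_left _ _ hf, Imat_mul_right _ _ hf]
  ext i j
  have i1 : IntegrableOn (fun s => (L * fI L M R s) i j) (Set.Ioi 0) := by
    simp only [Matrix.mul_apply]
    exact integrable_finset_sum _ fun k _ => (hf k j).const_mul (L i k)
  have i2 : IntegrableOn (fun s => (fI L M R s * R) i j) (Set.Ioi 0) := by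
    simp only [Matrix.mul_apply]
    exact integrable_finset_sum _ fun k _ => (hf i k).mul_const (R k j)
  have h := integral_Ioi_of_hasDerivAt_of_tendsto (f := fun s => fI L M R s i j)
    (a := 0) (m := 0) (fI_cont L M R i j).continuousWithinAt (fun s _ => fI_deriv L M R i j s)
    (i1.add i2).neg (fI_dec hL hR M i j).tendsto
  have h0 : fI L M R 0 i j = M i j := by simp [fI, mexp_eq]
  rw [integral_neg, integral_add i1 i2, h0] at h
  simp only [Matrix.add_apply, Imat, Matrix.of_apply]
  linarith

theorem Imat_psd (f : ℝ → Matrix (Fin p) (Fin p) ℝ)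
    (hf : ∀ i j, IntegrableOn (fun s => f s i j) (Set.Ioi 0)) (h : ∀ s, (f s).PosSemidef) :
    (Imat f).PosSemidef := by
  refine Matrix.PosSemidef.of_dotProduct_mulVec_nonneg ?_ ?_
  · ext i j
    have : ∀ s, f s j i = f s i j := fun s => by
      have := congrFun (congrFun (h s).1 i) j
      simpa using this
    simp [Imat, this]
  · intro x
    have : star x ⬝ᵥ (Imat f *ᵥ x) = ∫ s in Set.Ioi (0:ℝ), star x ⬝ᵥ (f s *ᵥ x) := by
      simp only [dotProduct, mulVec, Imat, Matrix.of_apply]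
      rw [integral_finset_sum]
      · refine Finset.sum_congr rfl fun i _ => ?_
        rw [integral_const_mul, integral_finset_sum]
        · simp only [integral_mul_const]
        · exact fun k _ => (hf i k).mul_const (x k)
      · intro i _
        exact (integrable_finset_sum _ fun k _ => (hf i k).mul_const (x k)).const_mul _
    rw [this]
    exact integral_nonneg fun s => (h s).dotProduct_mulVec_nonneg x

theorem fI_psd (A : Matrix (Fin p) (Fin p) ℝ) (C : Matrix (Fin 1) (Fin p) ℝ) (s : ℝ) :
    (fI Aᵀ (Cᵀ * C) A s).PosSemidef := by
  have : fI Aᵀ (Cᵀ * C) A s = (C * mexp (-(s • A)))ᴴ * (C * mexp (-(s • A))) := by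
    rw [fI, ← transpose_smul, ← transpose_neg, mexp_transpose, conjTranspose_eq_transpose_of_trivial,
      transpose_mul]
    simp only [Matrix.mul_assoc]
  rw [this]
  exact Matrix.posSemidef_conjTranspose_mul_self _

theorem F_unit (Z Q N : Matrix (Fin p) (Fin p) ℝ) (hQ : Q.PosSemidef) (hN : N.PosSemidef) :
    IsUnit (mexp Zᵀ + Q * mexp (-Z) * N) := by
  rw [← Matrix.mulVec_injective_iff_isUnit]
  rw [← Matrix.coe_mulVecLin, ← LinearMap.ker_eq_bot, LinearMap.ker_eq_bot']
  intro v hv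
  rw [Matrix.mulVecLin_apply, add_mulVec, ← mulVec_mulVec, ← mulVec_mulVec] at hv
  set y := mexp (-Z) *ᵥ (N *ᵥ v) with hy
  have h1 : N *ᵥ v = mexp Z *ᵥ y := by
    rw [hy, mulVec_mulVec, mexp_neg_mul, one_mulVec]
  have h2 : v ⬝ᵥ (N *ᵥ v) = -(y ⬝ᵥ (Q *ᵥ y)) := by
    rw [h1, dotProduct_mulVec, ← mulVec_transpose, ← mexp_transpose, eq_neg_of_add_eq_zero_left hv,
      neg_dotProduct, dotProduct_comm]
  have h3 := hQ.dotProduct_mulVec_nonneg y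
  have h4 := hN.dotProduct_mulVec_nonneg v
  simp only [star_trivial] at h3 h4
  have h5 : N *ᵥ v = 0 := by
    rw [← hN.dotProduct_mulVec_zero_iff, star_trivial]
    linarith
  have h6 : y = 0 := by rw [hy, h5, mulVec_zero]
  rw [h6, mulVec_zero, add_zero] at hv
  exact (Matrix.mulVec_injective_iff_isUnit.2 (mexp_isUnit Zᵀ)) (by rw [hv, mulVec_zero])

theorem mexp_intertwine (S X Y : Matrix (Fin p) (Fin p) ℝ) (hS : IsUnit S) (h : S * X = Y * S) :
    S * mexp X = mexp Y * S := by
  have hd : IsUnit S.det := (Matrix.isUnit_iff_isUnit_det _).1 hS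
  have : Y = S * X * S⁻¹ := by rw [h, Matrix.mul_nonsing_inv_cancel_right _ _ hd]
  rw [mexp_eq, mexp_eq, this, Matrix.exp_conj _ _ hS, Matrix.nonsing_inv_mul_cancel_right _ _ hd]

/-- observability matrix -/
def obsM (A : Matrix (Fin p) (Fin p) ℝ) (C : Matrix (Fin 1) (Fin p) ℝ) :
    Matrix (Fin p) (Fin p) ℝ := Matrix.of fun i j => (C * A ^ (i : ℕ)) 0 j

theorem obsM_unit (hp : 0 < p) (A : Matrix (Fin p) (Fin p) ℝ) (C : Matrix (Fin 1) (Fin p) ℝ)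
    (h : Observable A C) : IsUnit (obsM A C) := by
  rw [← Matrix.mulVec_injective_iff_isUnit]
  rw [← Matrix.coe_mulVecLin, ← LinearMap.ker_eq_bot, LinearMap.ker_eq_bot']
  intro v hv
  rw [Matrix.mulVecLin_apply] at hv
  have h0 : ∀ i < p, (C * A ^ i) *ᵥ v = 0 := by
    intro i hi
    funext k
    have : k = 0 := Subsingleton.elim _ _
    subst this
    exact congrFun hv ⟨i, hi⟩
  apply h
  intro r
  have : Nonempty (Fin p) := ⟨⟨0, hp⟩⟩
  have hdeg : (Polynomial.X ^ r %ₘ A.charpoly).natDegree < p := by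
    have h1 := Polynomial.natDegree_modByMonic_lt (Polynomial.X ^ r) A.charpoly_monic
      (by
        intro h1
        have := A.charpoly_natDegree_eq_dim
        rw [h1] at this
        simp at this
        omega)
    simpa [A.charpoly_natDegree_eq_dim] using h1
  rw [A.pow_eq_aeval_mod_charpoly r, Polynomial.aeval_eq_sum_range' hdeg, Matrix.mul_sum,
    Matrix.sum_mulVec]
  refine Finset.sum_eq_zero fun i hi => ?_
  rw [Matrix.mul_smul, smul_mulVec, h0 i (Finset.mem_range.1 hi), smul_zero]

theorem exists_S (hp : 0 < p) (A : Matrix (Fin p) (Fin p) ℝ)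
    (B : Matrix (Fin p) (Fin 1) ℝ) (C : Matrix (Fin 1) (Fin p) ℝ)
    (hobs : Observable A C) (hctrl : Controllable A B) :
    ∃ S : Matrix (Fin p) (Fin p) ℝ, IsUnit S ∧ S * A = Aᵀ * S ∧ S * B = Cᵀ ∧ Bᵀ * S = C := by
  have hO := obsM_unit hp A C hobs
  have hT := obsM_unit hp Aᵀ Bᵀ hctrl
  set O := obsM A C with hOdef
  set T := obsM Aᵀ Bᵀ with hTdef
  have hTd : IsUnit T.det := (Matrix.isUnit_iff_isUnit_det _).1 hT
  have tr : ∀ j : ℕ, Bᵀ * Aᵀ ^ j = (A ^ j * B)ᵀ := by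
    intro j; rw [transpose_mul, transpose_pow]
  have key : ∀ (m : ℕ), O * A ^ m * Tᵀ = T * Aᵀ ^ m * Oᵀ := by
    intro m
    have e1 : ∀ i j : Fin p, (O * A ^ m * Tᵀ) i j = (C * A ^ (i : ℕ) * A ^ m * (A ^ (j : ℕ) * B)) 0 0 := by
      intro i j
      simp only [Matrix.mul_apply (N := Tᵀ), Matrix.mul_apply (M := O),
        Matrix.mul_apply (N := A ^ (j : ℕ) * B), Matrix.mul_apply (M := C * A ^ (i : ℕ)) (N := A ^ m)]
      refine Finset.sum_congr rfl fun l _ => ?_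
      have : Tᵀ l j = (A ^ (j : ℕ) * B) l 0 := by
        change (Bᵀ * Aᵀ ^ (j : ℕ)) 0 l = _
        rw [tr]; rfl
      rw [this]; rfl
    have e2 : T * Aᵀ ^ m * Oᵀ = (O * A ^ m * Tᵀ)ᵀ := by
      simp only [transpose_mul, transpose_pow, transpose_transpose, Matrix.mul_assoc]
    rw [e2]
    ext i j
    rw [transpose_apply, e1, e1]
    have : C * A ^ (i : ℕ) * A ^ m * (A ^ (j : ℕ) * B) = C * A ^ (j : ℕ) * A ^ m * (A ^ (i : ℕ) * B) := by
      have hh : ∀ a b : ℕ, C * A ^ a * A ^ m * (A ^ b * B) = C * A ^ (a + m + b) * B := by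
        intro a b; simp only [pow_add, Matrix.mul_assoc]
      rw [hh, hh]; congr 3; omega
    rw [this]
  have k0 : O * Tᵀ = T * Oᵀ := by simpa using key 0
  have k1 : O * A * Tᵀ = T * Aᵀ * Oᵀ := by simpa using key 1
  have hTS : T * (T⁻¹ * O) = O := Matrix.mul_nonsing_inv_cancel_left _ _ hTd
  have hST : (T⁻¹ * O) * Tᵀ = Oᵀ := by
    rw [Matrix.mul_assoc, k0, Matrix.nonsing_inv_mul_cancel_left _ _ hTd]
  have hTt : IsUnit Tᵀ := (Matrix.isUnit_transpose _).2 hT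
  have hTi : IsUnit T⁻¹ := (Matrix.isUnit_nonsing_inv_iff).2 hT
  set S := T⁻¹ * O with hS
  have hsymm : Sᵀ = S := by
    apply hTt.mul_right_cancel
    rw [hST, ← transpose_mul, hTS]
  have hSB : S * B = Cᵀ := by
    have : T * (S * B) = T * Cᵀ := by
      rw [← Matrix.mul_assoc, hTS]
      ext i j
      have : j = 0 := Subsingleton.elim _ _
      subst this
      change (C * A ^ (i : ℕ) * B) 0 0 = (Bᵀ * Aᵀ ^ (i : ℕ) * Cᵀ) 0 0
      rw [tr, ← transpose_mul, transpose_apply, Matrix.mul_assoc]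
    have h2 := congrArg (T⁻¹ * ·) this
    simpa [Matrix.nonsing_inv_mul_cancel_left _ _ hTd] using h2
  refine ⟨S, hTi.mul hO, ?_, hSB, ?_⟩
  · apply hT.mul_left_cancel
    apply hTt.mul_right_cancel
    calc T * (S * A) * Tᵀ = (T * S) * A * Tᵀ := by noncomm_ring
      _ = T * Aᵀ * (S * Tᵀ) := by rw [hTS, k1, hST]
      _ = _ := by noncomm_ring
  · have := congrArg transpose hSB
    rwa [transpose_mul, hsymm, transpose_transpose] at this

theorem main_alg (hp : 0 < p) (A : Matrix (Fin p) (Fin p) ℝ)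
    (B : Matrix (Fin p) (Fin 1) ℝ) (C : Matrix (Fin 1) (Fin p) ℝ)
    (hA : EigPos A) (hobs : Observable A C) (hctrl : Controllable A B) (x t : ℝ) :
    IsUnit (Emat A B C x t) ∧ vFun A B C x t = uFun A B C x t := by
  have dA : DecM A := decR A hA
  have dAt : DecM Aᵀ := decM_transpose dA
  obtain ⟨S, hSu, hSA, hSB, hBS⟩ := exists_S hp A B C hobs hctrl
  have hSd : IsUnit S.det := (Matrix.isUnit_iff_isUnit_det _).1 hSu
  have hQ : Qmat A C = Imat (fI Aᵀ (Cᵀ * C) A) := rfl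
  have hN : Nmat A B = Imat (fI A (B * Bᵀ) Aᵀ) := rfl
  have hP : Pmat A B C = Imat (fI A (B * C) A) := rfl
  have hQp : (Qmat A C).PosSemidef := by
    rw [hQ]; exact Imat_psd _ (fI_int dAt dA _) (fI_psd A C)
  have hNp : (Nmat A B).PosSemidef := by
    rw [hN]
    refine Imat_psd _ (fI_int dA dAt _) fun s => ?_
    simpa using fI_psd Aᵀ Bᵀ s
  have hexp : ∀ s : ℝ, S * mexp (-(s • A)) = mexp (-(s • Aᵀ)) * S := by
    intro s
    refine mexp_intertwine _ _ _ hSu ?_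
    simp [hSA]
  have hQP : Qmat A C = S * Pmat A B C := by
    rw [hQ, hP, Imat_mul_left _ _ (fI_int dA dA _)]
    congr 1; funext s
    rw [fI, fI, ← hSB]
    simp only [← Matrix.mul_assoc, hexp]
  have hNP : Nmat A B * S = Pmat A B C := by
    rw [hN, hP, Imat_mul_right _ _ (fI_int dA dAt _)]
    congr 1; funext s
    rw [fI, fI, Matrix.mul_assoc, ← hexp]
    conv_rhs => rw [← hBS]
    simp only [Matrix.mul_assoc]
  have hFu : IsUnit (Fmat A B C x t) := by
    have := F_unit ((2 * x) • A - (8 * t) • A ^ 3) _ _ hQp hNp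
    have e1 : ((2*x)•A - (8*t)•A^3)ᵀ = (2*x)•Aᵀ - (8*t)•Aᵀ^3 := by simp [Matrix.transpose_pow]
    have e2 : -((2*x)•A - (8*t)•A^3) = -((2*x)•A) + (8*t)•A^3 := by abel
    rw [e1, e2] at this
    exact this
  have hSA3 : S * A ^ 3 = Aᵀ ^ 3 * S := (SemiconjBy.pow_right (a := S) (x := A) (y := Aᵀ) hSA 3).eq
  have hFS : Fmat A B C x t * S = S * Emat A B C x t := by
    have e : S * mexp ((2 * x) • A - (8 * t) • A ^ 3) = mexp ((2 * x) • Aᵀ - (8 * t) • Aᵀ ^ 3) * S := by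
      refine mexp_intertwine _ _ _ hSu ?_
      simp [Matrix.mul_sub, Matrix.sub_mul, hSA, hSA3]
    rw [Fmat, Emat, Matrix.add_mul, Matrix.mul_add, e, Matrix.mul_assoc _ (Nmat A B), hNP, hQP]
    simp only [Matrix.mul_assoc]
  have hEF : Emat A B C x t = S⁻¹ * Fmat A B C x t * S := by
    rw [Matrix.mul_assoc, hFS, Matrix.nonsing_inv_mul_cancel_left _ _ hSd]
  constructor
  · rw [hEF]
    exact ((Matrix.isUnit_nonsing_inv_iff.2 hSu).mul hFu).mul hSu
  · have hCS : C * S⁻¹ = Bᵀ := by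
      rw [← hBS, Matrix.mul_nonsing_inv_cancel_right _ _ hSd]
    rw [vFun, uFun, hEF, Matrix.mul_inv_rev, Matrix.mul_inv_rev, Matrix.nonsing_inv_nonsing_inv _ hSd,
      ← hSB, ← hCS]
    simp only [Matrix.mul_assoc]

open scoped Matrix.Norms.Operator in
theorem main_pde (A : Matrix (Fin p) (Fin p) ℝ)
    (B : Matrix (Fin p) (Fin 1) ℝ) (C : Matrix (Fin 1) (Fin p) ℝ)
    (hA : EigPos A) (hE : ∀ x t, IsUnit (Emat A B C x t)) (x t : ℝ) :
    deriv (fun τ : ℝ => vFun A B C x τ) t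
        + iteratedDeriv 3 (fun ξ : ℝ => vFun A B C ξ t) x
        + 6 * (vFun A B C x t) ^ 2 * deriv (fun ξ : ℝ => vFun A B C ξ t) x = 0 := by
  have dA : DecM A := decR A hA
  have hs : A * Pmat A B C + Pmat A B C * A = B * C := sylvester dA dA (B * C)
  let φ₀ : Matrix (Fin p) (Fin p) ℝ →ₗ[ℝ] ℝ :=
    { toFun := fun M => (C * M * B) 0 0
      map_add' := by intro M N; simp [Matrix.mul_add, Matrix.add_mul]
      map_smul' := by intro c M; simp }
  let φ : Matrix (Fin p) (Fin p) ℝ →L[ℝ] ℝ := LinearMap.toContinuousLinearMap φ₀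
  have hφ : ∀ M N, φ (M * (B * C) * N) = φ M * φ N := by
    intro M N
    change (C * (M * (B * C) * N) * B) 0 0 = (C * M * B) 0 0 * (C * N * B) 0 0
    have : C * (M * (B * C) * N) * B = (C * M * B) * (C * N * B) := by
      simp only [Matrix.mul_assoc]
    rw [this, Matrix.mul_apply]; simp
  have eE : ∀ x t, absE A (Pmat A B C) x t = Emat A B C x t := by
    intro x t
    rw [absE, absD, absD', Emat, mexp_eq, mexp_eq]
    rfl
  have ev : ∀ x t, vFun A B C x t = -2 * φ (Ring.inverse (absE A (Pmat A B C) x t)) := by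
    intro x t
    rw [eE, ← Matrix.nonsing_inv_eq_ringInverse]; rfl
  simp only [ev]
  exact abs_main A (Pmat A B C) (B * C) hs φ hφ (fun x t => by rw [eE]; exact hE x t) x t
end intg

theorem statement12 {p : ℕ} (hp : 0 < p) (A : Matrix (Fin p) (Fin p) ℝ)
    (B : Matrix (Fin p) (Fin 1) ℝ) (C : Matrix (Fin 1) (Fin p) ℝ)
    (hA : EigPos A) (hobs : Observable A C) (hctrl : Controllable A B) :
    ∀ x t : ℝ,
      (deriv (fun τ : ℝ => vFun A B C x τ) t
        + iteratedDeriv 3 (fun ξ : ℝ => vFun A B C ξ t) x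
        + 6 * (vFun A B C x t) ^ 2 * deriv (fun ξ : ℝ => vFun A B C ξ t) x = 0) ∧
      vFun A B C x t = uFun A B C x t := by

  have h := fun x t => main_alg hp A B C hA hobs hctrl x t
  exact fun x t => ⟨main_pde A B C hA (fun x t => (h x t).1) x t, (h x t).2⟩
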